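/- For every quadruple (a,b,c,d) ∈ ℕ⁴ with b ≥ 1 and d ≥ 1, setting n := a+b+c+d, there exist an integer N ≥ 1 and a polynomial P with rational coefficients in variables indexed by the quadruples (a',b',c',d') ∈ ℕ⁴ satisfying a'+b'+c'+d' ≤ n and b'·d' = 0, with the following property: for every function F analytic on a neighborhood of a point p ∈ ℂ⁴, holomorphic in each of the four variables (z, ζ, u, v), such that ∂_z∂_u F is nonvanishing near p and the Levi determinant F_{zu}F_{ζv} − F_{ζu}F_{zv} vanishes identically near p, one has, identically on a neighborhood of p: ∂_z^a ∂_ζ^b ∂_u^c ∂_v^d F = P(( ∂_z^{a'} ∂_ζ^{b'} ∂_u^{c'} ∂_v^{d'} F )_{(a',b',c',d')}) / (∂_z∂_u F)^N. -/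

import Mathlib

open Complex Filter Topology ComplexConjugate

/-- Partial derivative in the first (`z`) slot. -/
noncomputable def pdz (F : ℂ → ℂ → ℂ → ℂ → ℂ) : ℂ → ℂ → ℂ → ℂ → ℂ :=
  fun z ζ u v => deriv (fun t => F t ζ u v) z

/-- Partial derivative in the second (`ζ`) slot. -/
noncomputable def pdc (F : ℂ → ℂ → ℂ → ℂ → ℂ) : ℂ → ℂ → ℂ → ℂ → ℂ :=
  fun z ζ u v => deriv (fun t => F z t u v) ζ

/-- Partial derivative in the third (`u`, i.e. `z̄`) slot. -/
noncomputable def pdu (F : ℂ → ℂ → ℂ → ℂ → ℂ) : ℂ → ℂ → ℂ → ℂ → ℂ :=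
  fun z ζ u v => deriv (fun t => F z ζ t v) u

/-- Partial derivative in the fourth (`v`, i.e. `ζ̄`) slot. -/
noncomputable def pdv (F : ℂ → ℂ → ℂ → ℂ → ℂ) : ℂ → ℂ → ℂ → ℂ → ℂ :=
  fun z ζ u v => deriv (fun t => F z ζ u t) v

/-- Polarized rigid graphing function on `ℂ⁴`: analytic near the origin (hence holomorphic
in each of the four variables) and satisfying the reality condition near the origin. -/
def IsPolarized4 (F : ℂ → ℂ → ℂ → ℂ → ℂ) : Prop :=
  AnalyticAt ℂ (fun p : ℂ × ℂ × ℂ × ℂ => F p.1 p.2.1 p.2.2.1 p.2.2.2) 0 ∧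
    ∀ᶠ p : ℂ × ℂ × ℂ × ℂ in 𝓝 0,
      F p.1 p.2.1 p.2.2.1 p.2.2.2 =
        conj (F (conj p.2.2.1) (conj p.2.2.2) (conj p.1) (conj p.2.1))

/-- The Levi determinant `F_{zu}F_{ζv} − F_{ζu}F_{zv}`. -/
noncomputable def Levi (F : ℂ → ℂ → ℂ → ℂ → ℂ) : ℂ → ℂ → ℂ → ℂ → ℂ :=
  fun z ζ u v =>
    pdz (pdu F) z ζ u v * pdc (pdv F) z ζ u v -
      pdc (pdu F) z ζ u v * pdz (pdv F) z ζ u v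

/-- Taylor coefficient of `z^a ζ^b u^c v^d` in the expansion of `F` at the origin. -/
noncomputable def coeff4 (F : ℂ → ℂ → ℂ → ℂ → ℂ) (a b c d : ℕ) : ℂ :=
  (pdz^[a] (pdc^[b] (pdu^[c] (pdv^[d] F)))) 0 0 0 0 /
    ((a.factorial : ℂ) * (b.factorial : ℂ) * (c.factorial : ℂ) * (d.factorial : ℂ))

/-- Partial derivative in the first slot of a function of two variables. -/
noncomputable def p1 (f : ℂ → ℂ → ℂ) : ℂ → ℂ → ℂ := fun z ζ => deriv (fun t => f t ζ) z

/-- Partial derivative in the second slot of a function of two variables. -/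
noncomputable def p2 (f : ℂ → ℂ → ℂ) : ℂ → ℂ → ℂ := fun z ζ => deriv (fun t => f z t) ζ

/-- Jacobian determinant `f_z g_ζ − f_ζ g_z`. -/
noncomputable def Jac (f g : ℂ → ℂ → ℂ) : ℂ → ℂ → ℂ :=
  fun z ζ => p1 f z ζ * p2 g z ζ - p2 f z ζ * p1 g z ζ

/-- Conjugate function `f̄(u,v) := conj (f (conj u) (conj v))`. -/
noncomputable def bar2 (f : ℂ → ℂ → ℂ) : ℂ → ℂ → ℂ := fun u v => conj (f (conj u) (conj v))

/-- The polarized Gaussier–Merker model. -/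
noncomputable def gm : ℂ → ℂ → ℂ → ℂ → ℂ :=
  fun z ζ u v => (z * u + z ^ 2 * v / 2 + u ^ 2 * ζ / 2) / (1 - ζ * v)

/-- The mixed partial derivative `∂_z^a ∂_ζ^b ∂_u^c ∂_v^d F`. -/
noncomputable def pdMix (F : ℂ → ℂ → ℂ → ℂ → ℂ) (a b c d : ℕ) : ℂ → ℂ → ℂ → ℂ → ℂ :=
  pdz^[a] (pdc^[b] (pdu^[c] (pdv^[d] F)))

/-! ### Directional derivatives and jets of functions on `ℂ⁴` -/

/-- The directional derivative of `G` along `w`. -/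
noncomputable def dirDeriv (w : ℂ × ℂ × ℂ × ℂ) (G : ℂ × ℂ × ℂ × ℂ → ℂ) :
    ℂ × ℂ × ℂ × ℂ → ℂ :=
  fun x => fderiv ℂ G x w

/-- The uncurried form of a function of four variables. -/
def uncurry4 (F : ℂ → ℂ → ℂ → ℂ → ℂ) : ℂ × ℂ × ℂ × ℂ → ℂ :=
  fun x => F x.1 x.2.1 x.2.2.1 x.2.2.2

/-- The mixed derivative of `G` with multi-index `q`. -/
noncomputable def jet (G : ℂ × ℂ × ℂ × ℂ → ℂ) (q : ℕ × ℕ × ℕ × ℕ) : ℂ × ℂ × ℂ × ℂ → ℂ :=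
  (dirDeriv (1, 0, 0, 0))^[q.1] ((dirDeriv (0, 1, 0, 0))^[q.2.1]
    ((dirDeriv (0, 0, 1, 0))^[q.2.2.1] ((dirDeriv (0, 0, 0, 1))^[q.2.2.2] G)))

section Analysis

variable {G H : ℂ × ℂ × ℂ × ℂ → ℂ} {x : ℂ × ℂ × ℂ × ℂ}

theorem AnalyticAt.dirDeriv (h : AnalyticAt ℂ G x) (w : ℂ × ℂ × ℂ × ℂ) :
    AnalyticAt ℂ (dirDeriv w G) x :=
  ((ContinuousLinearMap.apply ℂ ℂ w).analyticAt _).comp h.fderiv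

theorem AnalyticAt.dirDeriv_iterate (h : AnalyticAt ℂ G x) (w : ℂ × ℂ × ℂ × ℂ) (n : ℕ) :
    AnalyticAt ℂ ((_root_.dirDeriv w)^[n] G) x := by
  induction n with
  | zero => exact h
  | succ n ih => rw [Function.iterate_succ_apply']; exact ih.dirDeriv w

theorem AnalyticAt.jet (h : AnalyticAt ℂ G x) (q : ℕ × ℕ × ℕ × ℕ) :
    AnalyticAt ℂ (jet G q) x :=
  (((h.dirDeriv_iterate _ _).dirDeriv_iterate _ _).dirDeriv_iterate _ _).dirDeriv_iterate _ _

theorem Filter.EventuallyEq.dirDeriv (h : G =ᶠ[𝓝 x] H) (w : ℂ × ℂ × ℂ × ℂ) :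
    dirDeriv w G =ᶠ[𝓝 x] dirDeriv w H := by
  filter_upwards [h.fderiv (𝕜 := ℂ)] with y hy
  simp only [_root_.dirDeriv, hy]

theorem Filter.EventuallyEq.dirDeriv_iterate (h : G =ᶠ[𝓝 x] H) (w : ℂ × ℂ × ℂ × ℂ) (n : ℕ) :
    (_root_.dirDeriv w)^[n] G =ᶠ[𝓝 x] (_root_.dirDeriv w)^[n] H := by
  induction n with
  | zero => exact h
  | succ n ih => simp only [Function.iterate_succ_apply']; exact ih.dirDeriv w

theorem dirDeriv_comm (h : AnalyticAt ℂ G x) (w w' : ℂ × ℂ × ℂ × ℂ) :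
    dirDeriv w (dirDeriv w' G) x = dirDeriv w' (dirDeriv w G) x := by
  have hd := h.fderiv.differentiableAt
  have hs : IsSymmSndFDerivAt ℂ G x :=
    (h.contDiffAt (n := 2)).isSymmSndFDerivAt (by simp)
  unfold dirDeriv
  rw [fderiv_clm_apply hd (differentiableAt_const _),
    fderiv_clm_apply hd (differentiableAt_const _)]
  simpa using hs w w'

theorem dirDeriv_comm_iterate (h : AnalyticAt ℂ G x) (w w' : ℂ × ℂ × ℂ × ℂ) (n : ℕ) :
    dirDeriv w ((dirDeriv w')^[n] G) =ᶠ[𝓝 x] (dirDeriv w')^[n] (dirDeriv w G) := by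
  induction n with
  | zero => rfl
  | succ n ih =>
    simp only [Function.iterate_succ_apply']
    refine EventuallyEq.trans ?_ (ih.dirDeriv w')
    filter_upwards [h.eventually_analyticAt] with y hy
    exact dirDeriv_comm (hy.dirDeriv_iterate w' n) w w'

theorem dirDeriv_jet_z (q : ℕ × ℕ × ℕ × ℕ) :
    dirDeriv (1, 0, 0, 0) (jet G q) = jet G (q + (1, 0, 0, 0)) :=
  (Function.iterate_succ_apply' _ _ _).symm

theorem dirDeriv_jet_c (h : AnalyticAt ℂ G x) (q : ℕ × ℕ × ℕ × ℕ) :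
    dirDeriv (0, 1, 0, 0) (jet G q) =ᶠ[𝓝 x] jet G (q + (0, 1, 0, 0)) := by
  refine (dirDeriv_comm_iterate
    (((h.dirDeriv_iterate _ _).dirDeriv_iterate _ _).dirDeriv_iterate _ _) _ _ _).trans ?_
  rw [← Function.iterate_succ_apply' (dirDeriv (0, 1, 0, 0))]
  rfl

theorem dirDeriv_jet_u (h : AnalyticAt ℂ G x) (q : ℕ × ℕ × ℕ × ℕ) :
    dirDeriv (0, 0, 1, 0) (jet G q) =ᶠ[𝓝 x] jet G (q + (0, 0, 1, 0)) := by
  have h₁ := (h.dirDeriv_iterate (0, 0, 0, 1) q.2.2.2).dirDeriv_iterate (0, 0, 1, 0) q.2.2.1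
  refine (dirDeriv_comm_iterate (h₁.dirDeriv_iterate _ _) _ _ _).trans ?_
  refine ((dirDeriv_comm_iterate h₁ _ _ _).dirDeriv_iterate _ _).trans ?_
  rw [← Function.iterate_succ_apply' (dirDeriv (0, 0, 1, 0))]
  rfl

theorem dirDeriv_jet_v (h : AnalyticAt ℂ G x) (q : ℕ × ℕ × ℕ × ℕ) :
    dirDeriv (0, 0, 0, 1) (jet G q) =ᶠ[𝓝 x] jet G (q + (0, 0, 0, 1)) := by
  have h₁ := h.dirDeriv_iterate (0, 0, 0, 1) q.2.2.2
  have h₂ := h₁.dirDeriv_iterate (0, 0, 1, 0) q.2.2.1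
  refine (dirDeriv_comm_iterate (h₂.dirDeriv_iterate _ _) _ _ _).trans ?_
  refine ((dirDeriv_comm_iterate h₂ _ _ _).dirDeriv_iterate _ _).trans ?_
  refine (((dirDeriv_comm_iterate h₁ _ _ _).dirDeriv_iterate _ _).dirDeriv_iterate _ _).trans ?_
  rw [← Function.iterate_succ_apply' (dirDeriv (0, 0, 0, 1))]
  rfl

end Analysis

section Partial

variable {F : ℂ → ℂ → ℂ → ℂ → ℂ} {G : ℂ × ℂ × ℂ × ℂ → ℂ} {x : ℂ × ℂ × ℂ × ℂ}

theorem deriv_comp_eq_fderiv (h : DifferentiableAt ℂ G x) {γ : ℂ → ℂ × ℂ × ℂ × ℂ} {t : ℂ}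
    {w : ℂ × ℂ × ℂ × ℂ} (hx : γ t = x) (hγ : HasDerivAt γ w t) :
    deriv (fun s => G (γ s)) t = fderiv ℂ G x w := by
  subst hx
  exact (h.hasFDerivAt.comp_hasDerivAt t hγ).deriv

theorem uncurry4_pdz (hG : AnalyticAt ℂ G x) (h : uncurry4 F =ᶠ[𝓝 x] G) :
    uncurry4 (pdz F) =ᶠ[𝓝 x] dirDeriv (1, 0, 0, 0) G := by
  filter_upwards [hG.eventually_analyticAt, h.eventuallyEq_nhds] with y hy hyF
  refine (deriv_comp_eq_fderiv (hy.congr hyF.symm).differentiableAt (x := y) rfl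
    ((hasDerivAt_id y.1).prodMk (hasDerivAt_const _ y.2))).trans ?_
  rw [hyF.fderiv_eq]
  rfl

theorem uncurry4_pdc (hG : AnalyticAt ℂ G x) (h : uncurry4 F =ᶠ[𝓝 x] G) :
    uncurry4 (pdc F) =ᶠ[𝓝 x] dirDeriv (0, 1, 0, 0) G := by
  filter_upwards [hG.eventually_analyticAt, h.eventuallyEq_nhds] with y hy hyF
  refine (deriv_comp_eq_fderiv (hy.congr hyF.symm).differentiableAt (x := y) rfl
    ((hasDerivAt_const _ y.1).prodMk
      ((hasDerivAt_id y.2.1).prodMk (hasDerivAt_const _ y.2.2)))).trans ?_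
  rw [hyF.fderiv_eq]
  rfl

theorem uncurry4_pdu (hG : AnalyticAt ℂ G x) (h : uncurry4 F =ᶠ[𝓝 x] G) :
    uncurry4 (pdu F) =ᶠ[𝓝 x] dirDeriv (0, 0, 1, 0) G := by
  filter_upwards [hG.eventually_analyticAt, h.eventuallyEq_nhds] with y hy hyF
  refine (deriv_comp_eq_fderiv (hy.congr hyF.symm).differentiableAt (x := y) rfl
    ((hasDerivAt_const _ y.1).prodMk ((hasDerivAt_const _ y.2.1).prodMk
      ((hasDerivAt_id y.2.2.1).prodMk (hasDerivAt_const _ y.2.2.2))))).trans ?_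
  rw [hyF.fderiv_eq]
  rfl

theorem uncurry4_pdv (hG : AnalyticAt ℂ G x) (h : uncurry4 F =ᶠ[𝓝 x] G) :
    uncurry4 (pdv F) =ᶠ[𝓝 x] dirDeriv (0, 0, 0, 1) G := by
  filter_upwards [hG.eventually_analyticAt, h.eventuallyEq_nhds] with y hy hyF
  refine (deriv_comp_eq_fderiv (hy.congr hyF.symm).differentiableAt (x := y) rfl
    ((hasDerivAt_const _ y.1).prodMk ((hasDerivAt_const _ y.2.1).prodMk
      ((hasDerivAt_const _ y.2.2.1).prodMk (hasDerivAt_id y.2.2.2))))).trans ?_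
  rw [hyF.fderiv_eq]
  rfl

theorem uncurry4_iterate {T : (ℂ → ℂ → ℂ → ℂ → ℂ) → ℂ → ℂ → ℂ → ℂ → ℂ}
    {w : ℂ × ℂ × ℂ × ℂ}
    (hT : ∀ {F G}, AnalyticAt ℂ G x → uncurry4 F =ᶠ[𝓝 x] G →
      uncurry4 (T F) =ᶠ[𝓝 x] dirDeriv w G)
    (hG : AnalyticAt ℂ G x) (h : uncurry4 F =ᶠ[𝓝 x] G) (n : ℕ) :
    uncurry4 (T^[n] F) =ᶠ[𝓝 x] (dirDeriv w)^[n] G := by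
  induction n with
  | zero => exact h
  | succ n ih =>
    simp only [Function.iterate_succ_apply']
    exact hT (hG.dirDeriv_iterate w n) ih

theorem uncurry4_pdMix (h : AnalyticAt ℂ (uncurry4 F) x) (a b c d : ℕ) :
    uncurry4 (pdMix F a b c d) =ᶠ[𝓝 x] jet (uncurry4 F) (a, b, c, d) := by
  have h₁ := h.dirDeriv_iterate (0, 0, 0, 1) d
  have h₂ := h₁.dirDeriv_iterate (0, 0, 1, 0) c
  have h₃ := h₂.dirDeriv_iterate (0, 1, 0, 0) b
  exact uncurry4_iterate uncurry4_pdz h₃ (uncurry4_iterate uncurry4_pdc h₂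
    (uncurry4_iterate uncurry4_pdu h₁ (uncurry4_iterate uncurry4_pdv h .rfl _) _) _) _

end Partial

/-! ### The ring of universal jet polynomials -/

open MvPolynomial

/-- The order of a multi-index. -/
def jetOrder (q : ℕ × ℕ × ℕ × ℕ) : ℕ := q.1 + q.2.1 + q.2.2.1 + q.2.2.2

/-- The total derivative of jet polynomials shifting multi-indices by `s`. -/
noncomputable def jetDerivation (s : ℕ × ℕ × ℕ × ℕ) :
    Derivation ℚ (MvPolynomial (ℕ × ℕ × ℕ × ℕ) ℚ) (MvPolynomial (ℕ × ℕ × ℕ × ℕ) ℚ) :=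
  mkDerivation ℚ fun q => X (q + s)

/-- Evaluation of a jet polynomial on the jets of `G`. -/
noncomputable def jetEval (G : ℂ × ℂ × ℂ × ℂ → ℂ) :
    MvPolynomial (ℕ × ℕ × ℕ × ℕ) ℚ →ₐ[ℚ] (ℂ × ℂ × ℂ × ℂ → ℂ) :=
  aeval (jet G)

theorem AnalyticAt.jetEval {G : ℂ × ℂ × ℂ × ℂ → ℂ} {x : ℂ × ℂ × ℂ × ℂ} (h : AnalyticAt ℂ G x)
    (P : MvPolynomial (ℕ × ℕ × ℕ × ℕ) ℚ) : AnalyticAt ℂ (jetEval G P) x := by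
  induction P using MvPolynomial.induction_on with
  | C r =>
    simp only [_root_.jetEval, aeval_C]
    exact analyticAt_const
  | add P Q hP hQ => rw [map_add]; exact hP.add hQ
  | mul_X P q hP =>
    rw [map_mul]
    refine hP.mul ?_
    simp only [_root_.jetEval, aeval_X]
    exact h.jet q

theorem dirDeriv_jetEval {w : ℂ × ℂ × ℂ × ℂ} {s : ℕ × ℕ × ℕ × ℕ}
    {G : ℂ × ℂ × ℂ × ℂ → ℂ} {x : ℂ × ℂ × ℂ × ℂ} (h : AnalyticAt ℂ G x)
    (hw : ∀ q, dirDeriv w (jet G q) x = jet G (q + s) x)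
    (P : MvPolynomial (ℕ × ℕ × ℕ × ℕ) ℚ) :
    dirDeriv w (jetEval G P) x = jetEval G (jetDerivation s P) x := by
  induction P using MvPolynomial.induction_on with
  | C r =>
    have : jetEval G (C r) = fun _ => (r : ℂ) := by
      simp only [jetEval, aeval_C]; rfl
    rw [this]
    simp [dirDeriv, jetDerivation]
  | add P Q hP hQ =>
    simp only [map_add, Pi.add_apply, ← hP, ← hQ, dirDeriv]
    rw [fderiv_add (h.jetEval P).differentiableAt (h.jetEval Q).differentiableAt]
    rfl
  | mul_X P q hP =>
    have hX : ∀ q, jetEval G (X q) = jet G q := fun q => by simp [jetEval]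
    have hD : jetDerivation s (X q) = X (q + s) := by simp [jetDerivation]
    have hq := hw q
    rw [Derivation.leibniz, hD]
    simp only [map_add, map_mul, smul_eq_mul, Pi.add_apply, Pi.mul_apply, ← hP, hX, ← hq]
    simp only [dirDeriv]
    rw [fderiv_mul (h.jetEval P).differentiableAt (h.jet q).differentiableAt]
    simp

/-- The Levi determinant as a jet polynomial. -/
noncomputable def leviPoly : MvPolynomial (ℕ × ℕ × ℕ × ℕ) ℚ :=
  X (1, 0, 1, 0) * X (0, 1, 0, 1) - X (0, 1, 1, 0) * X (1, 0, 0, 1)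

/-- The ideal of jet polynomials vanishing on all Levi degenerate analytic germs. -/
noncomputable def leviIdeal : Ideal (MvPolynomial (ℕ × ℕ × ℕ × ℕ) ℚ) where
  carrier := {P | ∀ (G : ℂ × ℂ × ℂ × ℂ → ℂ) (x : ℂ × ℂ × ℂ × ℂ), AnalyticAt ℂ G x →
    jetEval G leviPoly =ᶠ[𝓝 x] 0 → jetEval G P =ᶠ[𝓝 x] 0}
  zero_mem' G x _ _ := by rw [map_zero]
  add_mem' {P Q} hP hQ G x hG hL := by
    rw [map_add]
    simpa using (hP G x hG hL).add (hQ G x hG hL)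
  smul_mem' P Q hQ G x hG hL := by
    rw [smul_eq_mul, map_mul]
    simpa using (EventuallyEq.refl (𝓝 x) (jetEval G P)).mul (hQ G x hG hL)

theorem jetDerivation_mem_leviIdeal_of {w : ℂ × ℂ × ℂ × ℂ} {s : ℕ × ℕ × ℕ × ℕ}
    (hw : ∀ (G : ℂ × ℂ × ℂ × ℂ → ℂ) (x : ℂ × ℂ × ℂ × ℂ), AnalyticAt ℂ G x →
      ∀ q, dirDeriv w (jet G q) x = jet G (q + s) x)
    {P : MvPolynomial (ℕ × ℕ × ℕ × ℕ) ℚ} (hP : P ∈ leviIdeal) :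
    jetDerivation s P ∈ leviIdeal := by
  intro G x hG hL
  filter_upwards [hG.eventually_analyticAt, (hP G x hG hL).eventuallyEq_nhds] with y hy hPy
  rw [← dirDeriv_jetEval hy (hw G y hy), dirDeriv, hPy.fderiv_eq]
  simp

/-- The four unit multi-indices. -/
def unitIndices : Set (ℕ × ℕ × ℕ × ℕ) :=
  {(1, 0, 0, 0), (0, 1, 0, 0), (0, 0, 1, 0), (0, 0, 0, 1)}

theorem jetDerivation_mem_leviIdeal {s : ℕ × ℕ × ℕ × ℕ} (hs : s ∈ unitIndices)
    {P : MvPolynomial (ℕ × ℕ × ℕ × ℕ) ℚ} (hP : P ∈ leviIdeal) :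
    jetDerivation s P ∈ leviIdeal := by
  rcases hs with rfl | rfl | rfl | rfl
  · exact jetDerivation_mem_leviIdeal_of (fun G x _ q => congrFun (dirDeriv_jet_z q) x) hP
  · exact jetDerivation_mem_leviIdeal_of (fun G x h q => (dirDeriv_jet_c h q).eq_of_nhds) hP
  · exact jetDerivation_mem_leviIdeal_of (fun G x h q => (dirDeriv_jet_u h q).eq_of_nhds) hP
  · exact jetDerivation_mem_leviIdeal_of (fun G x h q => (dirDeriv_jet_v h q).eq_of_nhds) hP

theorem unitIndices_induction {p : ℕ × ℕ × ℕ × ℕ → Prop} (zero : p 0)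
    (add : ∀ q, ∀ s ∈ unitIndices, p q → p (q + s)) (q : ℕ × ℕ × ℕ × ℕ) : p q := by
  obtain ⟨a, b, c, d⟩ := q
  induction a with
  | succ a ih => simpa using add _ (1, 0, 0, 0) (by simp [unitIndices]) ih
  | zero =>
  induction b with
  | succ b ih => simpa using add _ (0, 1, 0, 0) (by simp [unitIndices]) ih
  | zero =>
  induction c with
  | succ c ih => simpa using add _ (0, 0, 1, 0) (by simp [unitIndices]) ih
  | zero =>
  induction d with
  | succ d ih => simpa using add _ (0, 0, 0, 1) (by simp [unitIndices]) ih
  | zero => exact zero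

theorem jetDerivation_mem_supported {s : ℕ × ℕ × ℕ × ℕ} {S T : Set (ℕ × ℕ × ℕ × ℕ)}
    (hST : ∀ q ∈ S, q ∈ T ∧ q + s ∈ T) {P : MvPolynomial (ℕ × ℕ × ℕ × ℕ) ℚ}
    (hP : P ∈ supported ℚ S) : jetDerivation s P ∈ supported ℚ T := by
  have hle : supported ℚ S ≤ supported ℚ T := supported_mono fun q hq => (hST q hq).1
  rw [supported_eq_adjoin_X] at hP
  induction hP using Algebra.adjoin_induction with
  | mem P hP =>
    obtain ⟨q, hq, rfl⟩ := hP
    simpa [jetDerivation, X_mem_supported] using (hST q hq).2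
  | algebraMap r => simp
  | add P Q _ _ hP hQ => rw [map_add]; exact add_mem hP hQ
  | mul P Q hP' hQ' hP hQ =>
    rw [← supported_eq_adjoin_X] at hP' hQ'
    rw [Derivation.leibniz]
    exact add_mem (mul_mem (hle hP') hQ) (mul_mem (hle hQ') hP)

/-- The multi-indices preceding `q` for the order of differentiation, then for the number of
derivatives in the variables `ζ` and `v`. -/
def lowerIndices (q : ℕ × ℕ × ℕ × ℕ) : Set (ℕ × ℕ × ℕ × ℕ) :=
  {q' | jetOrder q' < jetOrder q ∨
    jetOrder q' = jetOrder q ∧ q'.2.1 + q'.2.2.2 < q.2.1 + q.2.2.2}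

/-- Differentiating the Levi equation expresses a dependent jet by preceding jets. -/
theorem exists_lower_sub_mem_leviIdeal (q : ℕ × ℕ × ℕ × ℕ) :
    ∃ r ∈ supported ℚ (lowerIndices (q + (0, 1, 0, 1))),
      X (1, 0, 1, 0) * X (q + (0, 1, 0, 1)) - r ∈ leviIdeal := by
  induction q using unitIndices_induction with
  | zero =>
    refine ⟨X (0, 1, 1, 0) * X (1, 0, 0, 1), mul_mem ?_ ?_, fun G x _ hL => ?_⟩
    · exact X_mem_supported.2 (by simp [lowerIndices, jetOrder])
    · exact X_mem_supported.2 (by simp [lowerIndices, jetOrder])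
    · simpa [leviPoly] using hL
  | add q s hs ih =>
    obtain ⟨r, hr, hrI⟩ := ih
    refine ⟨jetDerivation s r - X (q + (0, 1, 0, 1)) * X ((1, 0, 1, 0) + s), ?_, ?_⟩
    · refine sub_mem (jetDerivation_mem_supported (fun q' hq' => ?_) hr)
        (mul_mem (X_mem_supported.2 ?_) (X_mem_supported.2 ?_))
      all_goals
        rcases hs with rfl | rfl | rfl | rfl <;>
        simp only [lowerIndices, jetOrder, Set.mem_ofPred_eq, Prod.fst_add, Prod.snd_add] at * <;>
        omega
    · convert jetDerivation_mem_leviIdeal hs hrI using 1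
      have hX : ∀ q', jetDerivation s (X q') = X (q' + s) := fun q' => by simp [jetDerivation]
      rw [map_sub, Derivation.leibniz, hX, hX, add_right_comm q s, smul_eq_mul, smul_eq_mul]
      ring

/-- The independent multi-indices of order at most `m`. -/
def independentIndices (m : ℕ) : Set (ℕ × ℕ × ℕ × ℕ) :=
  {q | q.1 + q.2.1 + q.2.2.1 + q.2.2.2 ≤ m ∧ q.2.1 * q.2.2.2 = 0}

theorem X_mem_supported_independentIndices {m : ℕ} (hm : 2 ≤ m) :
    (X (1, 0, 1, 0) : MvPolynomial (ℕ × ℕ × ℕ × ℕ) ℚ) ∈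
      supported ℚ (independentIndices m) :=
  X_mem_supported.2 (by simpa [independentIndices] using hm)

/-- The jet polynomials which, modulo the Levi ideal and up to a power of the jet `F_{zu}`,
are polynomials in the independent jets of order at most `m`. -/
noncomputable def resolvable (m : ℕ) (hm : 2 ≤ m) :
    Subalgebra ℚ (MvPolynomial (ℕ × ℕ × ℕ × ℕ) ℚ) where
  carrier := {P | ∃ N : ℕ, ∃ Q ∈ supported ℚ (independentIndices m),
    X (1, 0, 1, 0) ^ N * P - Q ∈ leviIdeal}
  algebraMap_mem' r := ⟨0, algebraMap _ _ r, Subalgebra.algebraMap_mem _ r, by simp⟩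
  add_mem' := by
    rintro P P' ⟨N, Q, hQ, h⟩ ⟨N', Q', hQ', h'⟩
    have hX := X_mem_supported_independentIndices hm
    refine ⟨N + N', X (1, 0, 1, 0) ^ N' * Q + X (1, 0, 1, 0) ^ N * Q',
      add_mem (mul_mem (pow_mem hX _) hQ) (mul_mem (pow_mem hX _) hQ'), ?_⟩
    convert add_mem (leviIdeal.mul_mem_left (X (1, 0, 1, 0) ^ N') h)
      (leviIdeal.mul_mem_left (X (1, 0, 1, 0) ^ N) h') using 1
    ring
  mul_mem' := by
    rintro P P' ⟨N, Q, hQ, h⟩ ⟨N', Q', hQ', h'⟩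
    refine ⟨N + N', Q * Q', mul_mem hQ hQ', ?_⟩
    convert add_mem (leviIdeal.mul_mem_left (X (1, 0, 1, 0) ^ N' * P') h)
      (leviIdeal.mul_mem_left Q h') using 1
    ring

theorem mem_resolvable_of_mul_sub_mem {m : ℕ} {hm : 2 ≤ m}
    {P R : MvPolynomial (ℕ × ℕ × ℕ × ℕ) ℚ} (hR : R ∈ resolvable m hm)
    (h : X (1, 0, 1, 0) * P - R ∈ leviIdeal) : P ∈ resolvable m hm := by
  obtain ⟨N, Q, hQ, hI⟩ := hR
  refine ⟨N + 1, Q, hQ, ?_⟩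
  convert add_mem (leviIdeal.mul_mem_left (X (1, 0, 1, 0) ^ N) h) hI using 1
  ring

theorem X_mem_resolvable {m : ℕ} (hm : 2 ≤ m) (q : ℕ × ℕ × ℕ × ℕ) (hq : jetOrder q ≤ m) :
    X q ∈ resolvable m hm := by
  by_cases hi : q.2.1 * q.2.2.2 = 0
  · exact ⟨0, X q, X_mem_supported.2 ⟨hq, hi⟩, by simp⟩
  · obtain ⟨hb, hd⟩ := mul_ne_zero_iff.1 hi
    obtain ⟨q₀, rfl⟩ : ∃ q₀, q = q₀ + (0, 1, 0, 1) :=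
      ⟨(q.1, q.2.1 - 1, q.2.2.1, q.2.2.2 - 1), by ext <;> simp <;> omega⟩
    obtain ⟨r, hr, hI⟩ := exists_lower_sub_mem_leviIdeal q₀
    refine mem_resolvable_of_mul_sub_mem ?_ hI
    rw [supported_eq_adjoin_X] at hr
    refine (Algebra.adjoin_le ?_ : _ ≤ resolvable m hm) hr
    rintro _ ⟨q', hq', rfl⟩
    have hlt : jetOrder q' ≤ m := by
      rcases hq' with h | h <;> omega
    exact X_mem_resolvable hm q' hlt
termination_by (jetOrder q, q.2.1 + q.2.2.2)
decreasing_by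
  rename_i h _ _ _ _ _
  subst h
  rcases hq' with h | ⟨h, hlow⟩
  · exact Prod.Lex.left _ _ h
  · rw [h]; exact Prod.Lex.right _ hlow

/-- The jet with multi-index `(a, b, c, d)` of a Levi degenerate function is a universal
polynomial in the independent jets divided by a power of `F_{zu}`. -/
theorem exists_pdMix_eq_aeval_div (a b c d : ℕ) (hm : 2 ≤ a + b + c + d) :
    ∃ N : ℕ, 1 ≤ N ∧ ∃ P : MvPolynomial (independentIndices (a + b + c + d)) ℚ,
      ∀ (F : ℂ → ℂ → ℂ → ℂ → ℂ) (p : ℂ × ℂ × ℂ × ℂ), AnalyticAt ℂ (uncurry4 F) p →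
        (∀ᶠ q in 𝓝 p, uncurry4 (pdz (pdu F)) q ≠ 0) →
        (∀ᶠ q in 𝓝 p, uncurry4 (Levi F) q = 0) →
        ∀ᶠ q in 𝓝 p, uncurry4 (pdMix F a b c d) q =
          aeval (fun i : independentIndices (a + b + c + d) =>
            uncurry4 (pdMix F i.1.1 i.1.2.1 i.1.2.2.1 i.1.2.2.2) q) P /
              uncurry4 (pdz (pdu F)) q ^ N := by
  obtain ⟨N, Q, hQ, hI⟩ := X_mem_resolvable hm (a, b, c, d) le_rfl
  rw [supported_eq_range_rename] at hQ
  obtain ⟨P, hP⟩ := hQ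
  replace hP : rename Subtype.val P = Q := hP
  subst hP
  have hzu : (1, 0, 1, 0) ∈ independentIndices (a + b + c + d) := ⟨hm, rfl⟩
  refine ⟨N + 1, by omega, X ⟨(1, 0, 1, 0), hzu⟩ * P, fun F p hF hne hL => ?_⟩
  have hjet : ∀ a b c d, uncurry4 (pdMix F a b c d) =ᶠ[𝓝 p] jet (uncurry4 F) (a, b, c, d) :=
    uncurry4_pdMix hF
  have hLevi : jetEval (uncurry4 F) leviPoly =ᶠ[𝓝 p] 0 := by
    filter_upwards [hL, hjet 1 0 1 0, hjet 0 1 0 1, hjet 0 1 1 0, hjet 1 0 0 1]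
      with q hq h₁ h₂ h₃ h₄
    simp only [leviPoly, jetEval, map_sub, map_mul, aeval_X, Pi.sub_apply, Pi.mul_apply,
      ← h₁, ← h₂, ← h₃, ← h₄]
    exact hq
  have hall : ∀ᶠ q in 𝓝 p, ∀ i : independentIndices (a + b + c + d),
      uncurry4 (pdMix F i.1.1 i.1.2.1 i.1.2.2.1 i.1.2.2.2) q = jet (uncurry4 F) i q := by
    have : Finite (independentIndices (a + b + c + d)) := by
      refine Set.Finite.subset (Set.finite_Iic
        (a + b + c + d, a + b + c + d, a + b + c + d, a + b + c + d)) fun q hq => ?_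
      have := hq.1
      exact ⟨by dsimp; omega, by dsimp; omega, by dsimp; omega, by dsimp; omega⟩
    exact eventually_all.2 fun i => hjet _ _ _ _
  filter_upwards [hne, hI _ p hF hLevi, hall, hjet a b c d, hjet 1 0 1 0]
    with q hq hIq hallq habcd hzuq
  have hz : jet (uncurry4 F) (1, 0, 1, 0) q = uncurry4 (pdz (pdu F)) q := hzuq.symm
  have hev : jetEval (uncurry4 F) (rename Subtype.val P) q =
      aeval (fun i : independentIndices (a + b + c + d) =>
        uncurry4 (pdMix F i.1.1 i.1.2.1 i.1.2.2.1 i.1.2.2.2) q) P := by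
    rw [jetEval, aeval_rename]
    have := comp_aeval_apply (fun i => jet (uncurry4 F) (i : independentIndices (a + b + c + d)).1)
      (Pi.evalAlgHom ℚ (fun _ : ℂ × ℂ × ℂ × ℂ => ℂ) q) P
    refine this.trans ?_
    congr 2
    funext i
    exact (hallq i).symm
  rw [map_sub, map_mul, map_pow] at hIq
  simp only [Pi.sub_apply, Pi.mul_apply, Pi.pow_apply, Pi.zero_apply] at hIq
  rw [hev] at hIq
  simp only [jetEval, aeval_X] at hIq
  rw [← habcd, hz, sub_eq_zero] at hIq
  rw [eq_div_iff (pow_ne_zero _ hq), map_mul, aeval_X, pow_succ, ← hIq]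
  change _ = uncurry4 (pdz (pdu F)) q * _
  ring

/-- under constant Levi rank 1, every 'dependent' jet `∂^{(a,b,c,d)}F` with
`b ≥ 1`, `d ≥ 1` is a universal rational expression, with denominator a power of `F_{zu}`,
in the 'independent' jets `∂^{(a',b',c',d')}F` with `b'·d' = 0` of order `≤ a+b+c+d`. -/
theorem stmt13 (a b c d : ℕ) (hb : 1 ≤ b) (hd : 1 ≤ d) :
    ∃ N : ℕ, 1 ≤ N ∧
      ∃ P : MvPolynomial
          {q : ℕ × ℕ × ℕ × ℕ //
            q.1 + q.2.1 + q.2.2.1 + q.2.2.2 ≤ a + b + c + d ∧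
              q.2.1 * q.2.2.2 = 0} ℚ,
        ∀ (F : ℂ → ℂ → ℂ → ℂ → ℂ) (p : ℂ × ℂ × ℂ × ℂ),
          AnalyticAt ℂ (fun q : ℂ × ℂ × ℂ × ℂ => F q.1 q.2.1 q.2.2.1 q.2.2.2) p →
          (∀ᶠ q : ℂ × ℂ × ℂ × ℂ in 𝓝 p,
            pdz (pdu F) q.1 q.2.1 q.2.2.1 q.2.2.2 ≠ 0) →
          (∀ᶠ q : ℂ × ℂ × ℂ × ℂ in 𝓝 p,
            Levi F q.1 q.2.1 q.2.2.1 q.2.2.2 = 0) →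
          ∀ᶠ q : ℂ × ℂ × ℂ × ℂ in 𝓝 p,
            pdMix F a b c d q.1 q.2.1 q.2.2.1 q.2.2.2 =
              (MvPolynomial.aeval
                  (fun i => pdMix F i.1.1 i.1.2.1 i.1.2.2.1 i.1.2.2.2
                    q.1 q.2.1 q.2.2.1 q.2.2.2) P) /
                (pdz (pdu F) q.1 q.2.1 q.2.2.1 q.2.2.2) ^ N := by
  exact exists_pdMix_eq_aeval_div a b c d (by omega)
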